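/- Let A be a k-bialgebra whose monoid of grouplike elements is commutative. Then the following are equivalent: (i) for every pair of grouplikes Q, Q′ of A, every Q-primitive a and every Q′-primitive a′, one has aQ′ ⊗ Qa′ + Qa′ ⊗ aQ′ − a′Q ⊗ Q′a − Q′a ⊗ a′Q = 0 in A ⊗_k A (primitive-grouplike compatibility); (ii) for every pair of grouplikes Q, Q′, every Q-primitive a and every Q′-primitive b, the commutator [a,b] = ab − ba is a QQ′-primitive; consequently, under either condition the generalized primitives of A are closed under the commutator bracket. -/

import Mathlib

/-!
Statement 1: primitive-grouplike compatibility is equivalent to closure of (skew-)primitives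
under the commutator bracket; consequently under either condition the generalized primitives
are closed under the commutator bracket.
-/

open TensorProduct

section Defs

variable (k A : Type*) [CommSemiring k] [Ring A] [Bialgebra k A]

/-- An element `Q` of a `k`-bialgebra `A` is *grouplike* if `Δ Q = Q ⊗ Q` and `ε Q = 1`. -/
def IsGrouplike (Q : A) : Prop :=
  Coalgebra.comul (R := k) Q = Q ⊗ₜ[k] Q ∧ Coalgebra.counit (R := k) Q = 1

/-- For `Q` a grouplike, `a` is a *`Q`-primitive* if `Δ a = a ⊗ Q + Q ⊗ a`. -/
def IsPrimitive (Q a : A) : Prop :=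
  Coalgebra.comul (R := k) a = a ⊗ₜ[k] Q + Q ⊗ₜ[k] a

/-- The `k`-submodule of *generalized primitives* of `A`: the span of all `Q`-primitives
for `Q` ranging over the grouplikes of `A`. -/
def genPrim : Submodule k A :=
  Submodule.span k {a : A | ∃ Q : A, IsGrouplike k A Q ∧ IsPrimitive k A Q a}

/-- `A` has *primitive-grouplike compatibility* if for all grouplikes `Q, Q′`, every
`Q`-primitive `a` and every `Q′`-primitive `a′`,
`aQ′ ⊗ Qa′ + Qa′ ⊗ aQ′ − a′Q ⊗ Q′a − Q′a ⊗ a′Q = 0` in `A ⊗ A`. -/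
def PrimGrouplikeCompat : Prop :=
  ∀ Q Q' a a' : A, IsGrouplike k A Q → IsGrouplike k A Q' →
    IsPrimitive k A Q a → IsPrimitive k A Q' a' →
    (a * Q') ⊗ₜ[k] (Q * a') + (Q * a') ⊗ₜ[k] (a * Q')
      - (a' * Q) ⊗ₜ[k] (Q' * a) - (Q' * a) ⊗ₜ[k] (a' * Q) = (0 : A ⊗[k] A)

end Defs

section Helpers

variable {k A : Type*} [CommSemiring k] [Ring A] [Bialgebra k A]

theorem IsGrouplike.mul {Q Q' : A} (hQ : IsGrouplike k A Q) (hQ' : IsGrouplike k A Q') :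
    IsGrouplike k A (Q * Q') := by
  constructor
  · rw [Bialgebra.comul_mul, hQ.1, hQ'.1, Algebra.TensorProduct.tmul_mul_tmul]
  · rw [Bialgebra.counit_mul, hQ.2, hQ'.2, mul_one]

theorem IsPrimitive.comul_mul {Q Q' a b : A} (ha : IsPrimitive k A Q a)
    (hb : IsPrimitive k A Q' b) :
    Coalgebra.comul (R := k) (a * b) =
      (a * b) ⊗ₜ[k] (Q * Q') + (Q * b) ⊗ₜ[k] (a * Q')
        + ((a * Q') ⊗ₜ[k] (Q * b) + (Q * Q') ⊗ₜ[k] (a * b)) := by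
  rw [Bialgebra.comul_mul, ha, hb]
  simp only [add_mul, mul_add, Algebra.TensorProduct.tmul_mul_tmul]

theorem IsPrimitive.commutator_iff {k A : Type*} [CommRing k] [Ring A] [Bialgebra k A]
    {Q Q' a b : A} (hQ : Q * Q' = Q' * Q) (ha : IsPrimitive k A Q a)
    (hb : IsPrimitive k A Q' b) :
    IsPrimitive k A (Q * Q') (a * b - b * a) ↔
      (a * Q') ⊗ₜ[k] (Q * b) + (Q * b) ⊗ₜ[k] (a * Q')
        - (b * Q) ⊗ₜ[k] (Q' * a) - (Q' * a) ⊗ₜ[k] (b * Q) = (0 : A ⊗[k] A) := by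
  rw [IsPrimitive, map_sub, ha.comul_mul hb, hb.comul_mul ha, ← hQ, TensorProduct.sub_tmul,
    TensorProduct.tmul_sub, ← sub_eq_zero]
  refine Eq.congr ?_ rfl
  abel

/-- The generalized primitives are closed under the commutator bracket as soon as commutators of
`Q`-primitives with `Q'`-primitives are `Q * Q'`-primitive. -/
theorem commutator_mem_genPrim
    (h : ∀ Q Q' a b : A, IsGrouplike k A Q → IsGrouplike k A Q' →
      IsPrimitive k A Q a → IsPrimitive k A Q' b → IsPrimitive k A (Q * Q') (a * b - b * a))
    {a b : A} (ha : a ∈ genPrim k A) (hb : b ∈ genPrim k A) :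
    a * b - b * a ∈ genPrim k A := by
  induction ha, hb using Submodule.span_induction₂ with
  | mem_mem a b ha hb =>
    obtain ⟨Q, hQ, ha⟩ := ha
    obtain ⟨Q', hQ', hb⟩ := hb
    exact Submodule.subset_span ⟨Q * Q', hQ.mul hQ', h Q Q' a b hQ hQ' ha hb⟩
  | zero_left b _ => simp
  | zero_right a _ => simp
  | add_left a a' b _ _ _ h₁ h₂ =>
    rw [add_mul, mul_add, add_sub_add_comm]
    exact add_mem h₁ h₂
  | add_right a b b' _ _ _ h₁ h₂ =>
    rw [add_mul, mul_add, add_sub_add_comm]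
    exact add_mem h₁ h₂
  | smul_left r a b _ _ h₁ =>
    rw [smul_mul_assoc, mul_smul_comm, ← smul_sub]
    exact Submodule.smul_mem _ r h₁
  | smul_right r a b _ _ h₁ =>
    rw [smul_mul_assoc, mul_smul_comm, ← smul_sub]
    exact Submodule.smul_mem _ r h₁

end Helpers

/-- Let `A` be a `k`-bialgebra whose monoid of grouplikes is commutative.
Then primitive-grouplike compatibility holds iff for all grouplikes `Q, Q′`, the commutator
of a `Q`-primitive and a `Q′`-primitive is a `QQ′`-primitive; consequently, under either
condition the generalized primitives of `A` are closed under the commutator bracket. -/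
theorem primGrouplikeCompat_iff_commutator_primitive (k A : Type*) [Field k] [Ring A]
    [Bialgebra k A]
    (hcomm : ∀ Q Q' : A, IsGrouplike k A Q → IsGrouplike k A Q' → Q * Q' = Q' * Q) :
    (PrimGrouplikeCompat k A ↔
      ∀ Q Q' a b : A, IsGrouplike k A Q → IsGrouplike k A Q' →
        IsPrimitive k A Q a → IsPrimitive k A Q' b →
        IsPrimitive k A (Q * Q') (a * b - b * a))
    ∧ (PrimGrouplikeCompat k A →
        ∀ a ∈ genPrim k A, ∀ b ∈ genPrim k A, a * b - b * a ∈ genPrim k A) := by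
  have key : PrimGrouplikeCompat k A ↔
      ∀ Q Q' a b : A, IsGrouplike k A Q → IsGrouplike k A Q' →
        IsPrimitive k A Q a → IsPrimitive k A Q' b →
        IsPrimitive k A (Q * Q') (a * b - b * a) :=
    forall₄_congr fun Q Q' _ _ => forall₄_congr fun hQ hQ' ha hb =>
      (ha.commutator_iff (hcomm Q Q' hQ hQ') hb).symm
  exact ⟨key, fun h _ ha _ hb => commutator_mem_genPrim (key.1 h) ha hb⟩
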